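/- arXiv:2006.13722 — 3 statements merged into one kernel-verified Lean document; each statement's English description precedes it below -/
import Mathlib

section
/- Every stacked triangulation on exactly 6 vertices has exactly one edge e such that the singleton {e} is an edge guard set (i.e., every face of G contains an endpoint of e, and e is the unique edge with this property). -/
namespace Guarding

/-- `IsStacked V E out F` means: the finite simple graph with vertex set `V`, edge set `E`
(edges as unordered pairs), outer face `out` and set of inner faces `F`
(each face identified with its 3-element set of boundary vertices)
is a stacked triangulation, built by the inductive construction:
the triangle on three vertices is a stacked triangulation whose outer face is `{x,y,z}` and
whose set of inner faces is `{{x,y,z}}`; stacking a new vertex `v` into an inner face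
`{x,y,z}` adds the edges `vx, vy, vz` and replaces the face `{x,y,z}` by the three faces
`{v,x,y}, {v,y,z}, {v,z,x}`. -/
inductive IsStacked : Finset ℕ → Finset (Sym2 ℕ) → Finset ℕ → Finset (Finset ℕ) → Prop
  | base (x y z : ℕ) (hxy : x ≠ y) (hyz : y ≠ z) (hxz : x ≠ z) :
      IsStacked {x, y, z} {s(x, y), s(y, z), s(x, z)} {x, y, z} {{x, y, z}}
  | stack {V : Finset ℕ} {E : Finset (Sym2 ℕ)} {out : Finset ℕ} {F : Finset (Finset ℕ)}
      (x y z v : ℕ) (hG : IsStacked V E out F) (hf : ({x, y, z} : Finset ℕ) ∈ F)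
      (hv : v ∉ V) :
      IsStacked (insert v V) (E ∪ {s(v, x), s(v, y), s(v, z)}) out
        ((F.erase {x, y, z}) ∪ {{v, x, y}, {v, y, z}, {v, z, x}})

/-- The faces of the stacked triangulation: its inner faces together with the outer face. -/
def faces (out : Finset ℕ) (F : Finset (Finset ℕ)) : Finset (Finset ℕ) := insert out F

/-- `V(Γ)`: the set of all endpoints of edges of `Γ`. -/
def gv (Γ : Finset (Sym2 ℕ)) : Set ℕ := {u | ∃ e ∈ Γ, u ∈ e}

/-- `Γ` is an edge guard set: it consists of edges of the graph and every face
contains at least one endpoint of an edge of `Γ`. -/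
def IsGuardSet (E : Finset (Sym2 ℕ)) (out : Finset ℕ) (F : Finset (Finset ℕ))
    (Γ : Finset (Sym2 ℕ)) : Prop :=
  Γ ⊆ E ∧ ∀ f ∈ faces out F, ∃ u ∈ gv Γ, u ∈ f

lemma nodup_of_insert_eq {x y z a b c : ℕ} (h : ({x, y, z} : Finset ℕ) = {a, b, c})
    (hd : [a, b, c].Nodup) : [x, y, z].Nodup := by
  have hc : ({x, y, z} : Finset ℕ).card = 3 := by
    rw [h, Finset.card_eq_three]
    exact ⟨a, b, c, by simp_all, by simp_all, by simp_all, rfl⟩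
  have := Multiset.toFinset_card_eq_card_iff_nodup (m := (↑[x, y, z] : Multiset ℕ))
  simpa [hc] using this

/-- The three faces created by stacking `v` into a face depend only on the face as a set. -/
lemma new_faces_eq_image {x y z : ℕ} (v : ℕ) (hd : [x, y, z].Nodup) :
    ({{v, x, y}, {v, y, z}, {v, z, x}} : Finset (Finset ℕ)) =
      ({x, y, z} : Finset ℕ).image fun w ↦ insert v (({x, y, z} : Finset ℕ).erase w) := by
  have h1 : ({x, y, z} : Finset ℕ).erase x = {y, z} := by ext; simp at *; grind
  have h2 : ({x, y, z} : Finset ℕ).erase y = {z, x} := by ext; simp at *; grind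
  have h3 : ({x, y, z} : Finset ℕ).erase z = {x, y} := by ext; simp at *; grind
  simp only [Finset.image_insert, Finset.image_singleton, h1, h2, h3]
  ext; simp; tauto

lemma new_faces_congr {x y z a b c : ℕ} (v : ℕ) (h : ({x, y, z} : Finset ℕ) = {a, b, c})
    (hd : [a, b, c].Nodup) :
    ({{v, x, y}, {v, y, z}, {v, z, x}} : Finset (Finset ℕ)) =
      {{v, a, b}, {v, b, c}, {v, c, a}} := by
  rw [new_faces_eq_image v hd, new_faces_eq_image v (nodup_of_insert_eq h hd), h]

lemma new_edges_congr {x y z a b c : ℕ} (v : ℕ) (h : ({x, y, z} : Finset ℕ) = {a, b, c}) :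
    ({s(v, x), s(v, y), s(v, z)} : Finset (Sym2 ℕ)) = {s(v, a), s(v, b), s(v, c)} := by
  simpa using congrArg (Finset.image fun w ↦ s(v, w)) h

lemma IsStacked.out_subset {V : Finset ℕ} {E : Finset (Sym2 ℕ)} {out : Finset ℕ}
    {F : Finset (Finset ℕ)} (hG : IsStacked V E out F) : out ⊆ V := by
  induction hG with
  | base => rfl
  | stack x y z v hG hf hv ih => exact ih.trans (Finset.subset_insert _ _)

lemma IsStacked.three_le_card {V : Finset ℕ} {E : Finset (Sym2 ℕ)} {out : Finset ℕ}
    {F : Finset (Finset ℕ)} (hG : IsStacked V E out F) : 3 ≤ V.card := by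
  induction hG with
  | base x y z hxy hyz hxz =>
    exact (Finset.card_eq_three.2 ⟨x, y, z, hxy, hxz, hyz, rfl⟩).ge
  | stack x y z v hG hf hv ih =>
    exact ih.trans (Finset.card_le_card (Finset.subset_insert _ _))

/-- Once a vertex has been stacked, the outer face is no longer an inner face. -/
lemma IsStacked.out_notMem_or {V : Finset ℕ} {E : Finset (Sym2 ℕ)} {out : Finset ℕ}
    {F : Finset (Finset ℕ)} (hG : IsStacked V E out F) :
    (V.card = 3 ∧ F = {out}) ∨ (3 < V.card ∧ out ∉ F) := by
  induction hG with
  | base x y z hxy hyz hxz =>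
    exact .inl ⟨Finset.card_eq_three.2 ⟨x, y, z, hxy, hxz, hyz, rfl⟩, rfl⟩
  | stack x y z v hG hf hv ih =>
    have hvo := fun h ↦ hv (hG.out_subset h)
    have := hG.three_le_card
    refine .inr ⟨by rw [Finset.card_insert_of_notMem hv]; omega, fun h ↦ ?_⟩
    rw [Finset.mem_union] at h
    rcases h with h | h
    · rw [Finset.mem_erase] at h
      rcases ih with ⟨-, rfl⟩ | ih
      · exact h.1 ((Finset.mem_singleton.1 h.2).trans (Finset.mem_singleton.1 hf).symm)
      · exact ih.2 h.2
    · simp only [Finset.mem_insert, Finset.mem_singleton] at h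
      rcases h with rfl | rfl | rfl <;> simp at hvo

/-- The combinatorics of a stacking step in terms of the set of all faces. -/
lemma IsStacked.exists_stack {V : Finset ℕ} {E : Finset (Sym2 ℕ)} {out : Finset ℕ}
    {F : Finset (Finset ℕ)} (hG : IsStacked V E out F) (hn : 4 < V.card) :
    ∃ V' E' F' x y z v, IsStacked V' E' out F' ∧ {x, y, z} ∈ faces out F' ∧ v ∉ V' ∧
      V'.card + 1 = V.card ∧ V = insert v V' ∧ E = E' ∪ {s(v, x), s(v, y), s(v, z)} ∧
      faces out F =
        (faces out F').erase {x, y, z} ∪ {{v, x, y}, {v, y, z}, {v, z, x}} := by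
  cases hG with
  | base x y z hxy hyz hxz =>
    rw [Finset.card_eq_three.2 ⟨x, y, z, hxy, hxz, hyz, rfl⟩] at hn
    omega
  | @stack V' E' _ F' x y z v hG hf hv =>
    rw [Finset.card_insert_of_notMem hv] at hn ⊢
    have ho : out ∉ F' := by
      rcases hG.out_notMem_or with h | h
      · omega
      · exact h.2
    refine ⟨V', E', F', x, y, z, v, hG, Finset.mem_insert_of_mem hf, hv, rfl, rfl, rfl, ?_⟩
    rw [faces, faces, Finset.erase_insert_of_ne (by rintro rfl; exact ho hf),
      Finset.insert_union]

lemma exists_labels_of_card_eq_four {V : Finset ℕ} {E : Finset (Sym2 ℕ)} {out : Finset ℕ}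
    {F : Finset (Finset ℕ)} (hG : IsStacked V E out F) (hn : V.card = 4) :
    ∃ a b c d, [a, b, c, d].Nodup ∧ V = {a, b, c, d} ∧
      E = {s(a, b), s(b, c), s(a, c), s(d, a), s(d, b), s(d, c)} ∧
      faces out F = {{a, b, c}, {d, a, b}, {d, b, c}, {d, c, a}} := by
  cases hG with
  | base x y z hxy hyz hxz =>
    rw [Finset.card_eq_three.2 ⟨x, y, z, hxy, hxz, hyz, rfl⟩] at hn
    omega
  | stack x y z v hG hf hv =>
    rw [Finset.card_insert_of_notMem hv] at hn
    cases hG with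
    | base a b c hab hbc hac =>
      have h := Finset.mem_singleton.1 hf
      have hd : [a, b, c].Nodup := by simp [*]
      refine ⟨a, b, c, v, by simp at *; grind, ?_, ?_, ?_⟩
      · simp [Finset.Subset.antisymm_iff, Finset.insert_subset_iff]
      · rw [new_edges_congr v h]
        simp [Finset.Subset.antisymm_iff, Finset.insert_subset_iff]
      · rw [new_faces_congr v h hd, h, faces]; simp
    | stack x' y' z' v' hG' hf' hv' =>
      have := hG'.three_le_card
      rw [Finset.card_insert_of_notMem hv'] at hn
      omega

/-- The four faces of a tetrahedron are equivalent under relabelling. -/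
lemma exists_relabel_tetrahedron {a b c d : ℕ} {f : Finset ℕ} (hd : [a, b, c, d].Nodup)
    (hf : f ∈ ({{a, b, c}, {d, a, b}, {d, b, c}, {d, c, a}} : Finset (Finset ℕ))) :
    ∃ a' b' c' d', [a', b', c', d'].Nodup ∧ f = {a', b', c'} ∧
      ({a, b, c, d} : Finset ℕ) = {a', b', c', d'} ∧
      ({s(a, b), s(b, c), s(a, c), s(d, a), s(d, b), s(d, c)} : Finset (Sym2 ℕ)) =
        {s(a', b'), s(b', c'), s(a', c'), s(d', a'), s(d', b'), s(d', c')} ∧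
      ({{a, b, c}, {d, a, b}, {d, b, c}, {d, c, a}} : Finset (Finset ℕ)) =
        {{a', b', c'}, {d', a', b'}, {d', b', c'}, {d', c', a'}} := by
  have sw : ∀ x y : ℕ, s(x, y) = s(y, x) := fun _ _ ↦ Sym2.eq_swap
  have rot : ∀ x y z : ℕ, ({x, y, z} : Finset ℕ) = {y, z, x} := by intros; ext; simp; tauto
  have tr : ∀ x y z : ℕ, ({x, y, z} : Finset ℕ) = {y, x, z} := by intros; ext; simp; tauto
  simp only [Finset.mem_insert, Finset.mem_singleton] at hf
  rcases hf with rfl | rfl | rfl | rfl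
  · exact ⟨a, b, c, d, hd, rfl, rfl, rfl, rfl⟩
  · refine ⟨d, a, b, c, by simp at hd ⊢; grind, rfl, ?_, ?_, ?_⟩ <;>
      ext <;> simp only [Finset.mem_insert, Finset.mem_singleton] <;> grind
  · refine ⟨d, b, c, a, by simp at hd ⊢; grind, rfl, ?_, ?_, ?_⟩ <;>
      ext <;> simp only [Finset.mem_insert, Finset.mem_singleton] <;> grind
  · refine ⟨d, c, a, b, by simp at hd ⊢; grind, rfl, ?_, ?_, ?_⟩ <;>
      ext <;> simp only [Finset.mem_insert, Finset.mem_singleton] <;> grind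

/-- On five vertices the only stacked triangulation is the bipyramid with apices `p`, `q` over
the triangle `a`, `b`, `c`. -/
lemma exists_labels_of_card_eq_five {V : Finset ℕ} {E : Finset (Sym2 ℕ)} {out : Finset ℕ}
    {F : Finset (Finset ℕ)} (hG : IsStacked V E out F) (hn : V.card = 5) :
    ∃ a b c p q, [a, b, c, p, q].Nodup ∧ V = {a, b, c, p, q} ∧
      E = {s(a, b), s(b, c), s(a, c), s(p, a), s(p, b), s(p, c), s(q, a), s(q, b), s(q, c)} ∧
      faces out F = {{p, a, b}, {p, b, c}, {p, c, a}, {q, a, b}, {q, b, c}, {q, c, a}} := by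
  obtain ⟨V', E', F', x, y, z, v, hG', hf, hv, hc, rfl, rfl, hF⟩ := hG.exists_stack (by omega)
  obtain ⟨a₀, b₀, c₀, d₀, hd₀, hV₀, hE₀, hF₀⟩ :=
    exists_labels_of_card_eq_four hG' (by omega)
  rw [hF₀] at hf
  obtain ⟨a, b, c, p, hd, h, hV, hE, hA⟩ := exists_relabel_tetrahedron hd₀ hf
  rw [hV] at hV₀
  subst hV₀
  refine ⟨a, b, c, p, v, by simp at *; grind, ?_, ?_, ?_⟩
  · simp [Finset.Subset.antisymm_iff, Finset.insert_subset_iff]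
  · rw [hE₀, hE, new_edges_congr v h]
    simp [Finset.Subset.antisymm_iff, Finset.insert_subset_iff]
  · rw [hF, hF₀, hA, new_faces_congr v h (by simp at *; grind), h, Finset.erase_insert]
    · simp [Finset.Subset.antisymm_iff, Finset.insert_subset_iff]
    · have : p ∉ ({a, b, c} : Finset ℕ) := by simp at *; grind
      simp only [Finset.mem_insert, Finset.mem_singleton]
      rintro (h | h | h) <;> exact this (h ▸ Finset.mem_insert_self _ _)

/-- The six faces of a bipyramid are equivalent under relabelling. -/
lemma exists_relabel_bipyramid {a b c p q : ℕ} {f : Finset ℕ} (hd : [a, b, c, p, q].Nodup)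
    (hf : f ∈ ({{p, a, b}, {p, b, c}, {p, c, a}, {q, a, b}, {q, b, c}, {q, c, a}} :
      Finset (Finset ℕ))) :
    ∃ a' b' c' p' q', [a', b', c', p', q'].Nodup ∧ f = {p', a', b'} ∧
      ({a, b, c, p, q} : Finset ℕ) = {a', b', c', p', q'} ∧
      ({s(a, b), s(b, c), s(a, c), s(p, a), s(p, b), s(p, c), s(q, a), s(q, b), s(q, c)} :
        Finset (Sym2 ℕ)) =
        {s(a', b'), s(b', c'), s(a', c'), s(p', a'), s(p', b'), s(p', c'),
          s(q', a'), s(q', b'), s(q', c')} ∧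
      ({{p, a, b}, {p, b, c}, {p, c, a}, {q, a, b}, {q, b, c}, {q, c, a}} :
        Finset (Finset ℕ)) =
        {{p', a', b'}, {p', b', c'}, {p', c', a'}, {q', a', b'}, {q', b', c'},
          {q', c', a'}} := by
  simp only [Finset.mem_insert, Finset.mem_singleton] at hf
  rcases hf with rfl | rfl | rfl | rfl | rfl | rfl
  · exact ⟨a, b, c, p, q, hd, rfl, rfl, rfl, rfl⟩
  · refine ⟨b, c, a, p, q, by simp at hd ⊢; grind, rfl, ?_, ?_, ?_⟩ <;>
      simp [Finset.Subset.antisymm_iff, Finset.insert_subset_iff]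
  · refine ⟨c, a, b, p, q, by simp at hd ⊢; grind, rfl, ?_, ?_, ?_⟩ <;>
      simp [Finset.Subset.antisymm_iff, Finset.insert_subset_iff]
  · refine ⟨a, b, c, q, p, by simp at hd ⊢; grind, rfl, ?_, ?_, ?_⟩ <;>
      simp [Finset.Subset.antisymm_iff, Finset.insert_subset_iff]
  · refine ⟨b, c, a, q, p, by simp at hd ⊢; grind, rfl, ?_, ?_, ?_⟩ <;>
      simp [Finset.Subset.antisymm_iff, Finset.insert_subset_iff]
  · refine ⟨c, a, b, q, p, by simp at hd ⊢; grind, rfl, ?_, ?_, ?_⟩ <;>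
      simp [Finset.Subset.antisymm_iff, Finset.insert_subset_iff]

/-- On six vertices the only stacked triangulation is the bipyramid with a vertex `v` stacked
into the face `{p, a, b}`. -/
lemma exists_labels_of_card_eq_six {V : Finset ℕ} {E : Finset (Sym2 ℕ)} {out : Finset ℕ}
    {F : Finset (Finset ℕ)} (hG : IsStacked V E out F) (hn : V.card = 6) :
    ∃ a b c p q v, [a, b, c, p, q, v].Nodup ∧
      E = {s(a, b), s(b, c), s(a, c), s(p, a), s(p, b), s(p, c), s(q, a), s(q, b), s(q, c),
        s(v, p), s(v, a), s(v, b)} ∧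
      faces out F = {{p, b, c}, {p, c, a}, {q, a, b}, {q, b, c}, {q, c, a},
        {v, p, a}, {v, a, b}, {v, b, p}} := by
  obtain ⟨V', E', F', x, y, z, v, hG', hf, hv, hc, rfl, rfl, hF⟩ := hG.exists_stack (by omega)
  obtain ⟨a₀, b₀, c₀, p₀, q₀, hd₀, hV₀, hE₀, hF₀⟩ :=
    exists_labels_of_card_eq_five hG' (by omega)
  rw [hF₀] at hf
  obtain ⟨a, b, c, p, q, hd, h, hV, hE, hA⟩ :=
    exists_relabel_bipyramid hd₀ hf
  rw [hV] at hV₀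
  subst hV₀
  refine ⟨a, b, c, p, q, v, by simp at *; grind, ?_, ?_⟩
  · rw [hE₀, hE, new_edges_congr v h]
    simp [Finset.Subset.antisymm_iff, Finset.insert_subset_iff]
  · rw [hF, hF₀, hA, new_faces_congr v h (by simp at *; grind), h, Finset.erase_insert]
    · simp [Finset.Subset.antisymm_iff, Finset.insert_subset_iff]
    · have hq : q ∉ ({p, a, b} : Finset ℕ) := by simp at *; grind
      have hc : c ∉ ({p, a, b} : Finset ℕ) := by simp at *; grind
      simp only [Finset.mem_insert, Finset.mem_singleton]
      rintro (h | h | h | h | h) <;> first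
        | (apply hc; rw [h]; simp; done)
        | (apply hq; rw [h]; simp)

lemma existsUnique_guard_edge {a b c p q v : ℕ} (hd : [a, b, c, p, q, v].Nodup) :
    ∃! e : Sym2 ℕ,
      e ∈ ({s(a, b), s(b, c), s(a, c), s(p, a), s(p, b), s(p, c), s(q, a), s(q, b), s(q, c),
        s(v, p), s(v, a), s(v, b)} : Finset (Sym2 ℕ)) ∧
      ∀ f ∈ ({{p, b, c}, {p, c, a}, {q, a, b}, {q, b, c}, {q, c, a},
        {v, p, a}, {v, a, b}, {v, b, p}} : Finset (Finset ℕ)), ∃ u ∈ e, u ∈ f := by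
  refine ⟨s(a, b), by simp, ?_⟩
  rintro e ⟨he, hf⟩
  simp only [Finset.forall_mem_insert, Finset.mem_singleton, forall_eq] at hf
  simp only [Finset.mem_insert, Finset.mem_singleton] at he
  simp only [List.nodup_cons, List.mem_cons, List.not_mem_nil, or_false, not_or] at hd
  rcases he with rfl | rfl | rfl | rfl | rfl | rfl | rfl | rfl | rfl | rfl | rfl | rfl <;>
    simp [Sym2.mem_iff] at hf ⊢ <;> grind

/-- Every stacked triangulation on exactly `6` vertices has exactly one edge `e`
such that `{e}` is an edge guard set. -/
theorem six_vertex_unique_guard (V : Finset ℕ) (E : Finset (Sym2 ℕ)) (out : Finset ℕ)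
    (F : Finset (Finset ℕ)) (hG : IsStacked V E out F) (hn : V.card = 6) :
    ∃! e : Sym2 ℕ, e ∈ E ∧ ∀ f ∈ faces out F, ∃ u ∈ e, u ∈ f := by
  obtain ⟨a, b, c, p, q, v, hd, hE, hF⟩ := exists_labels_of_card_eq_six hG hn
  rw [hE, hF]
  exact existsUnique_guard_edge hd

end Guarding
end

section
/- Let G be a stacked triangulation on exactly 7 vertices with outer face {x,y,z}, and let u ∈ {x,y,z}. Then there exists an edge e of G such that every face of G that does not contain u contains an endpoint of e. -/
namespace Guarding

theorem ne_of_card_triple_eq_three {a b c : ℕ} (h : ({a, b, c} : Finset ℕ).card = 3) :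
    a ≠ b ∧ a ≠ c ∧ b ≠ c := by
  refine ⟨?_, ?_, ?_⟩ <;> rintro rfl
  · rw [Finset.insert_idem] at h
    exact absurd h (Finset.card_le_two.trans_lt (by norm_num)).ne
  · rw [Finset.insert_eq_of_mem (by simp)] at h
    exact absurd h (Finset.card_le_two.trans_lt (by norm_num)).ne
  · rw [Finset.pair_eq_singleton] at h
    exact absurd h (Finset.card_le_two.trans_lt (by norm_num)).ne

/-- The faces of a stacked triangulation are triples of its vertices. -/
theorem IsStacked.card_eq_three_and_subset {V : Finset ℕ} {E : Finset (Sym2 ℕ)} {out : Finset ℕ}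
    {F : Finset (Finset ℕ)} (hG : IsStacked V E out F) : ∀ f ∈ F, f.card = 3 ∧ f ⊆ V := by
  induction hG with
  | base x y z hxy hyz hxz =>
    intro f hf
    rw [Finset.mem_singleton.1 hf]
    exact ⟨Finset.card_eq_three.2 ⟨x, y, z, hxy, hxz, hyz, rfl⟩, subset_rfl⟩
  | @stack V E out F x y z v _ hf hv ih =>
    obtain ⟨hcard, hsub⟩ := ih _ hf
    obtain ⟨hxy, hxz, hyz⟩ := ne_of_card_triple_eq_three hcard
    have hx : x ∈ V := hsub (by simp)
    have hy : y ∈ V := hsub (by simp)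
    have hz : z ∈ V := hsub (by simp)
    have hnew {a b : ℕ} (ha : a ∈ V) (hb : b ∈ V) (hab : a ≠ b) :
        ({v, a, b} : Finset ℕ).card = 3 ∧ {v, a, b} ⊆ insert v V :=
      ⟨Finset.card_eq_three.2
        ⟨v, a, b, fun h => hv (h ▸ ha), fun h => hv (h ▸ hb), hab, rfl⟩, by
        grind⟩
    intro g hg
    simp only [Finset.mem_union, Finset.mem_insert, Finset.mem_singleton] at hg
    rcases hg with hg | rfl | rfl | rfl
    · obtain ⟨h3, hs⟩ := ih g (Finset.mem_of_mem_erase hg)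
      exact ⟨h3, hs.trans (Finset.subset_insert _ _)⟩
    · exact hnew hx hy hxy
    · exact hnew hy hz hyz
    · exact hnew hz hx hxz.symm

/-- A list of edges and a list of inner faces, both on vertices labelled by order of insertion. -/
abbrev Code := List (ℕ × ℕ) × List (List ℕ)

/-- Stack the new vertex `n` into the face `f`. -/
def Code.stack (n : ℕ) (G : Code) (f : List ℕ) : Code :=
  (f.map (fun w => (n, w)) ++ G.1, f.map (fun w => n :: f.filter (· ≠ w)) ++ G.2.erase f)

/-- All labelled stacked triangulations with `k` inner vertices and outer face `{0, 1, 2}`. -/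
def codes : ℕ → List Code
  | 0 => [([(0, 1), (1, 2), (0, 2)], [[0, 1, 2]])]
  | k + 1 => (codes k).flatMap fun G => G.2.map (G.stack (k + 3))

theorem lt_of_mem_codes {k : ℕ} {G : Code} (hG : G ∈ codes k) :
    (∀ p ∈ G.1, p.1 < k + 3 ∧ p.2 < k + 3) ∧ ∀ g ∈ G.2, ∀ w ∈ g, w < k + 3 := by
  induction k generalizing G with
  | zero =>
    obtain rfl := List.mem_singleton.1 hG
    decide
  | succ k ih =>
    simp only [codes, List.mem_flatMap, List.mem_map] at hG
    obtain ⟨H, hH, f, hf, rfl⟩ := hG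
    obtain ⟨hE, hF⟩ := ih hH
    constructor
    · intro p hp
      simp only [Code.stack, List.mem_append, List.mem_map] at hp
      grind
    · intro g hg
      simp only [Code.stack, List.mem_append, List.mem_map] at hg
      rcases hg with ⟨w, hw, rfl⟩ | hg
      · grind
      · have := hF g (List.mem_of_mem_erase hg)
        grind

/-- Every stacked triangulation with `k` inner vertices is the image of some `G ∈ codes k` under a
relabelling `φ` of the vertices. -/
theorem IsStacked.exists_code {V : Finset ℕ} {E : Finset (Sym2 ℕ)} {out : Finset ℕ}
    {F : Finset (Finset ℕ)} (hG : IsStacked V E out F) :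
    ∃ (k : ℕ) (φ : ℕ → ℕ) (G : Code), V.card = k + 3 ∧ G ∈ codes k ∧
      out = {φ 0, φ 1, φ 2} ∧ (∀ p ∈ G.1, s(φ p.1, φ p.2) ∈ E) ∧
      ∀ f ∈ F, ∃ g ∈ G.2, (g.map φ).Nodup ∧ (g.map φ).toFinset = f := by
  induction hG with
  | base x y z hxy hyz hxz =>
    refine ⟨0, fun | 0 => x | 1 => y | _ => z, _,
      Finset.card_eq_three.2 ⟨x, y, z, hxy, hxz, hyz, rfl⟩, List.mem_singleton_self _, rfl, ?_, ?_⟩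
    · simp
    · simp [hxy, hyz, hxz]
  | @stack V E out F x y z v hG hf hv ih =>
    obtain ⟨k, φ, G, hk, hGk, hout, hE, hF⟩ := ih
    obtain ⟨hEk, hFk⟩ := lt_of_mem_codes hGk
    obtain ⟨g, hg, hnd, hgf⟩ := hF _ hf
    obtain ⟨hcard, hsub⟩ := hG.card_eq_three_and_subset _ hf
    have hmem (t : ℕ) : t ∈ ({x, y, z} : Finset ℕ) ↔ ∃ w ∈ g, φ w = t := by
      rw [← hgf]; simp
    have hinj := List.inj_on_of_nodup_map hnd
    set ψ := Function.update φ (k + 3) v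
    have hψn : ψ (k + 3) = v := Function.update_self ..
    have hψo {w : ℕ} (hw : w < k + 3) : ψ w = φ w := Function.update_of_ne hw.ne ..
    have hψl {l : List ℕ} (hl : ∀ w ∈ l, w < k + 3) : l.map ψ = l.map φ :=
      List.map_congr_left fun w hw => hψo (hl w hw)
    have hnew {a b : ℕ} (c : ℕ) (h : ({x, y, z} : Finset ℕ) = {a, b, c}) :
        ∃ g' ∈ (G.stack (k + 3) g).2, (g'.map ψ).Nodup ∧
          (g'.map ψ).toFinset = {v, a, b} := by
      obtain ⟨w, hw, hwc⟩ := (hmem c).1 (by simp [h])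
      have hl : ∀ t ∈ g.filter (· ≠ w), t < k + 3 := fun t ht =>
        hFk g hg t (List.mem_of_mem_filter ht)
      refine ⟨(k + 3) :: g.filter (· ≠ w),
        List.mem_append_left _ (List.mem_map_of_mem hw), ?_, ?_⟩
      · rw [List.map_cons, hψl hl, hψn, List.nodup_cons]
        refine ⟨?_, hnd.sublist (List.filter_sublist.map φ)⟩
        rw [List.mem_map]
        rintro ⟨t, ht, rfl⟩
        exact hv (hsub ((hmem _).2 ⟨t, List.mem_of_mem_filter ht, rfl⟩))
      · obtain ⟨-, hac, hbc⟩ := ne_of_card_triple_eq_three (h ▸ hcard)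
        rw [List.map_cons, hψl hl, hψn, List.toFinset_cons]
        congr 1
        ext t
        have ht := hmem t
        rw [h] at ht
        simp only [Finset.mem_insert, Finset.mem_singleton] at ht
        simp only [List.mem_toFinset, List.mem_map, List.mem_filter, Finset.mem_insert,
          Finset.mem_singleton, decide_eq_true_eq]
        constructor
        · rintro ⟨r, ⟨hr, hrw⟩, rfl⟩
          have := ht.2 ⟨r, hr, rfl⟩
          have : φ r ≠ c := fun hc => hrw (hinj hr hw (hc.trans hwc.symm))
          tauto
        · intro hab
          obtain ⟨r, hr, rfl⟩ := ht.1 (by tauto)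
          refine ⟨r, ⟨hr, ?_⟩, rfl⟩
          rintro rfl
          rw [hwc] at hab
          exact hab.elim hac.symm hbc.symm
    refine ⟨k + 1, ψ, G.stack (k + 3) g, ?_, ?_, ?_, ?_, ?_⟩
    · rw [Finset.card_insert_of_notMem hv, hk]
    · exact List.mem_flatMap.2 ⟨G, hGk, List.mem_map_of_mem hg⟩
    · rw [hψo (by omega), hψo (by omega), hψo (by omega), hout]
    · intro p hp
      rcases List.mem_append.1 hp with hp | hp
      · obtain ⟨w, hw, rfl⟩ := List.mem_map.1 hp
        have := (hmem (φ w)).2 ⟨w, hw, rfl⟩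
        simp only [Finset.mem_insert, Finset.mem_singleton] at this
        rw [hψn, hψo (hFk g hg w hw)]
        rcases this with h | h | h <;> simp [h]
      · rw [hψo (hEk p hp).1, hψo (hEk p hp).2]
        exact Finset.mem_union_left _ (hE p hp)
    · intro f' hf'
      simp only [Finset.mem_union, Finset.mem_insert, Finset.mem_singleton] at hf'
      rcases hf' with hf' | rfl | rfl | rfl
      · obtain ⟨hne, hf'⟩ := Finset.mem_erase.1 hf'
        obtain ⟨g', hg', hnd', rfl⟩ := hF f' hf'
        refine ⟨g', List.mem_append_right _ ((List.mem_erase_of_ne ?_).2 hg'), ?_⟩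
        · rintro rfl
          exact hne hgf
        · rw [hψl (hFk g' hg')]
          exact ⟨hnd', rfl⟩
      · exact hnew z rfl
      · exact hnew x (by grind)
      · exact hnew y (by grind)

theorem exists_guard_of_mem_codes_four : ∀ G ∈ codes 4, ∀ i ∈ [0, 1, 2], ∃ e ∈ G.1, ∀ g ∈ G.2,
    i ∉ g → e.1 ∈ g ∨ e.2 ∈ g := by
  decide +kernel

/-- Let `G` be a stacked triangulation on exactly `7` vertices with outer face `{x,y,z}`
and let `u ∈ {x,y,z}`. Then there is an edge `e` of `G` such that every face of `G`
not containing `u` contains an endpoint of `e`. -/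
theorem seven_vertex_guard_avoiding (V : Finset ℕ) (E : Finset (Sym2 ℕ))
    (F : Finset (Finset ℕ)) (x y z u : ℕ)
    (hxy : x ≠ y) (hyz : y ≠ z) (hxz : x ≠ z)
    (hG : IsStacked V E {x, y, z} F) (hn : V.card = 7)
    (hu : u ∈ ({x, y, z} : Finset ℕ)) :
    ∃ e ∈ E, ∀ f ∈ faces {x, y, z} F, u ∉ f → ∃ w ∈ (e : Sym2 ℕ), w ∈ f := by
  obtain ⟨k, φ, G, hk, hGk, hout, hE, hF⟩ := hG.exists_code
  obtain rfl : k = 4 := by omega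
  obtain ⟨i, hi, rfl⟩ : ∃ i ∈ [0, 1, 2], φ i = u := by
    rw [hout] at hu
    simp only [Finset.mem_insert, Finset.mem_singleton] at hu
    rcases hu with rfl | rfl | rfl <;> simp
  obtain ⟨e, he, hguard⟩ := exists_guard_of_mem_codes_four G hGk i hi
  refine ⟨_, hE e he, fun f hf hif => ?_⟩
  obtain rfl | hf := Finset.mem_insert.1 hf
  · exact absurd hu hif
  · obtain ⟨g, hg, -, rfl⟩ := hF f hf
    simp only [List.mem_toFinset] at hif ⊢
    rcases hguard g hg fun h => hif (List.mem_map_of_mem h) with h | h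
    · exact ⟨_, Sym2.mem_mk_left _ _, List.mem_map_of_mem h⟩
    · exact ⟨_, Sym2.mem_mk_right _ _, List.mem_map_of_mem h⟩

end Guarding
end

section
/- Let G₀ be a stacked triangulation with an inner face f = {x,y,z}, and let G be the stacked triangulation obtained from G₀ by stacking a new vertex a into f (adding edges ax, ay, az), then stacking a new vertex b into the face {a,x,y} (adding edges ab, bx, by), and then stacking a new vertex c into the face {a,b,x} (adding edges ac, bc, cx). Then for every edge guard set Γ of G there exists an edge guard set Γ' of G with |Γ'| ≤ |Γ|, with x ∈ V(Γ'), and containing an edge vw ∈ Γ' with v ∈ {x,y,z} and w ∈ {a,b,c}. -/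
namespace Guarding

namespace IsStacked

variable {V : Finset ℕ} {E : Finset (Sym2 ℕ)} {out : Finset ℕ} {F : Finset (Finset ℕ)}

lemma outer_subset (h : IsStacked V E out F) : out ⊆ V := by
  induction h with
  | base => exact subset_rfl
  | stack x y z v _ _ _ ih => exact ih.trans (Finset.subset_insert _ _)

lemma face_subset (h : IsStacked V E out F) : ∀ f ∈ F, f ⊆ V := by
  induction h with
  | base => simp
  | stack x y z v _ hf _ ih =>
    have := ih _ hf
    intro f hfF
    simp only [Finset.mem_union, Finset.mem_erase, Finset.mem_insert, Finset.mem_singleton] at hfF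
    rcases hfF with ⟨-, hfF⟩ | rfl | rfl | rfl
    · exact (ih f hfF).trans (Finset.subset_insert _ _)
    all_goals grind

lemma mem_of_mem_edge (h : IsStacked V E out F) : ∀ e ∈ E, ∀ u ∈ e, u ∈ V := by
  induction h with
  | base => simp
  | stack x y z v hG hf _ ih =>
    have := hG.face_subset _ hf
    simp only [Finset.mem_union, Finset.mem_insert, Finset.mem_singleton]
    rintro e (he | rfl | rfl | rfl) u hu
    · exact Or.inr (ih e he u hu)
    all_goals simp only [Sym2.mem_iff] at hu; grind

lemma card_face (h : IsStacked V E out F) : ∀ f ∈ F, f.card = 3 := by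
  induction h with
  | base x y z hxy hyz hxz => simpa using Finset.card_eq_three.2 ⟨x, y, z, hxy, hxz, hyz, rfl⟩
  | stack x y z v hG hf hv ih =>
    have hV := hG.face_subset _ hf
    have hxyz := ih _ hf
    have hd : x ≠ y ∧ y ≠ z ∧ z ≠ x := by
      refine ⟨?_, ?_, ?_⟩ <;> rintro rfl <;> simp at hxyz <;>
        grind [Finset.card_le_two]
    have hvx : v ≠ x ∧ v ≠ y ∧ v ≠ z := by grind
    simp only [Finset.mem_union, Finset.mem_erase, Finset.mem_insert, Finset.mem_singleton]
    rintro f (⟨-, hfF⟩ | rfl | rfl | rfl)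
    · exact ih f hfF
    all_goals exact Finset.card_eq_three.2 ⟨_, _, _, by grind, by grind, by grind, rfl⟩

lemma edge_of_mem_face (h : IsStacked V E out F) :
    ∀ f ∈ F, ∀ u ∈ f, ∀ w ∈ f, u ≠ w → s(u, w) ∈ E := by
  induction h with
  | base => simp
  | stack x y z v hG hf hv ih =>
    have hxyz := ih _ hf
    simp only [Finset.mem_union, Finset.mem_erase, Finset.mem_insert, Finset.mem_singleton]
      at hxyz ⊢
    rintro f (⟨-, hfF⟩ | rfl | rfl | rfl) u hu w hw huw
    · exact Or.inl (ih f hfF u hu w hw huw)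
    all_goals
      simp only [Finset.mem_insert, Finset.mem_singleton] at hu hw
      grind [Sym2.eq_swap]

end IsStacked

lemma mem_gv_left {Γ : Finset (Sym2 ℕ)} {u w : ℕ} (h : s(u, w) ∈ Γ) : u ∈ gv Γ :=
  ⟨_, h, Sym2.mem_mk_left u w⟩

lemma mem_gv_right {Γ : Finset (Sym2 ℕ)} {u w : ℕ} (h : s(u, w) ∈ Γ) : w ∈ gv Γ :=
  ⟨_, h, Sym2.mem_mk_right u w⟩

/-- Vertices lost by exchanging an edge lie on the removed edge. -/
lemma mem_gv_insert_erase {Γ : Finset (Sym2 ℕ)} (r s : Sym2 ℕ) {u : ℕ} (hu : u ∈ gv Γ)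
    (hur : u ∉ r) : u ∈ gv (insert s (Γ.erase r)) := by
  obtain ⟨e, he, hue⟩ := hu
  exact ⟨e, Finset.mem_insert_of_mem (Finset.mem_erase.2 ⟨by rintro rfl; exact hur hue, he⟩), hue⟩

lemma card_insert_erase_le {Γ : Finset (Sym2 ℕ)} {r : Sym2 ℕ} (hr : r ∈ Γ) (s : Sym2 ℕ) :
    (insert s (Γ.erase r)).card ≤ Γ.card :=
  (Finset.card_insert_le _ _).trans_eq (Finset.card_erase_add_one hr)

/-- Strong forcing lemma: let `G₀` be a stacked triangulation with inner face `{x,y,z}`,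
and let `G` be obtained from `G₀` by stacking `a` into `{x,y,z}`, then `b` into `{a,x,y}`,
then `c` into `{a,b,x}`. Then every edge guard set `Γ` of `G` can be replaced by an edge
guard set `Γ'` of `G` with `|Γ'| ≤ |Γ|`, `x ∈ V(Γ')`, and an edge `vw ∈ Γ'` with
`v ∈ {x,y,z}` and `w ∈ {a,b,c}`. -/
theorem strong_forcing (V : Finset ℕ) (E : Finset (Sym2 ℕ)) (out : Finset ℕ)
    (F : Finset (Finset ℕ)) (x y z a b c : ℕ)
    (hG0 : IsStacked V E out F) (hf : ({x, y, z} : Finset ℕ) ∈ F)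
    (ha : a ∉ V) (hb : b ∉ insert a V) (hc : c ∉ insert b (insert a V))
    (E' : Finset (Sym2 ℕ)) (F' : Finset (Finset ℕ))
    (hE' : E' = ((E ∪ {s(a, x), s(a, y), s(a, z)}) ∪ {s(b, a), s(b, x), s(b, y)})
        ∪ {s(c, a), s(c, b), s(c, x)})
    (hF' : F' = (((((F.erase {x, y, z}) ∪ {{a, x, y}, {a, y, z}, {a, z, x}}).erase {a, x, y})
        ∪ {{b, a, x}, {b, x, y}, {b, y, a}}).erase {a, b, x})
        ∪ {{c, a, b}, {c, b, x}, {c, x, a}})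
    (Γ : Finset (Sym2 ℕ)) (hΓ : IsGuardSet E' out F' Γ) :
    ∃ Γ' : Finset (Sym2 ℕ), IsGuardSet E' out F' Γ' ∧ Γ'.card ≤ Γ.card ∧
      x ∈ gv Γ' ∧
      ∃ v w : ℕ, s(v, w) ∈ Γ' ∧ v ∈ ({x, y, z} : Finset ℕ) ∧ w ∈ ({a, b, c} : Finset ℕ) := by
  have hfV := hG0.face_subset _ hf
  have hxV : x ∈ V := hfV (by simp)
  have hyV : y ∈ V := hfV (by simp)
  have hzV : z ∈ V := hfV (by simp)
  have hyz : y ≠ z := by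
    rintro rfl
    have := hG0.card_face _ hf
    have := Finset.card_le_two (a := x) (b := y)
    simp_all
  have hyzE : s(y, z) ∈ E := hG0.edge_of_mem_face _ hf y (by simp) z (by simp) hyz
  obtain ⟨hba, hbV⟩ : b ≠ a ∧ b ∉ V := by simpa using hb
  obtain ⟨hcb, hca, hcV⟩ : c ≠ b ∧ c ≠ a ∧ c ∉ V := by simpa using hc
  obtain ⟨hΓE, hΓF⟩ := hΓ
  have haxE : s(a, x) ∈ E' := by simp [hE']
  have hyzE' : s(y, z) ∈ E' := by simp [hE', hyzE]
  have guards {Δ : Finset (Sym2 ℕ)} (hΔ : Δ ⊆ E') (hx : x ∈ gv Δ) (ha' : a ∈ gv Δ)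
      (hV : ∀ u ∈ V, u ∈ gv Γ → u ∈ gv Δ) : IsGuardSet E' out F' Δ := by
    refine ⟨hΔ, fun f hfF => ?_⟩
    have hold (h : f ⊆ V) : ∃ u ∈ gv Δ, u ∈ f := by
      obtain ⟨u, hu, huf⟩ := hΓF f hfF
      exact ⟨u, hV u (h huf) hu, huf⟩
    have hcases : f = out ∨ f ∈ F ∨ x ∈ f ∨ a ∈ f := by
      simp only [faces, hF', Finset.mem_union, Finset.mem_erase, Finset.mem_insert,
        Finset.mem_singleton] at hfF
      rcases hfF with h | ⟨-, (⟨-, (⟨-, h⟩ | h | h | h)⟩ | h | h | h)⟩ | h | h | h <;> simp [h]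
    rcases hcases with rfl | h | h | h
    · exact hold hG0.outer_subset
    · exact hold (hG0.face_subset f h)
    · exact ⟨x, hx, h⟩
    · exact ⟨a, ha', h⟩
  have exchange {r s : Sym2 ℕ} {Δ : Finset (Sym2 ℕ)} (hΔ : Δ ⊆ E') (hs : s ∈ E') :
      insert s (Δ.erase r) ⊆ E' :=
    Finset.insert_subset hs ((Finset.erase_subset _ _).trans hΔ)
  by_cases hr : ∃ r ∈ Γ, ∀ w ∈ V, w ∉ r
  · obtain ⟨r, hrΓ, hrV⟩ := hr
    refine ⟨insert s(a, x) (Γ.erase r), guards (exchange hΓE haxE) ?_ ?_ fun u hu huΓ => ?_,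
      card_insert_erase_le hrΓ _, ?_, x, a, ?_, by simp, by simp⟩
    · exact mem_gv_right (Finset.mem_insert_self _ _)
    · exact mem_gv_left (Finset.mem_insert_self _ _)
    · exact mem_gv_insert_erase _ _ huΓ (hrV u hu)
    · exact mem_gv_right (Finset.mem_insert_self _ _)
    · rw [Sym2.eq_swap]; exact Finset.mem_insert_self _ _
  push Not at hr
  have hnew : ∀ u ∈ gv Γ, u ∉ V →
      (u = a ∧ (s(a, x) ∈ Γ ∨ s(a, y) ∈ Γ ∨ s(a, z) ∈ Γ)) ∨
      (u = b ∧ (s(b, x) ∈ Γ ∨ s(b, y) ∈ Γ)) ∨ (u = c ∧ s(c, x) ∈ Γ) := by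
    rintro u ⟨e, he, hue⟩ huV
    have heE := hΓE he
    simp only [hE', Finset.mem_union, Finset.mem_insert, Finset.mem_singleton] at heE
    have hold := hG0.mem_of_mem_edge e
    have hinner {v w : ℕ} (hv : v ∉ V) (hw : w ∉ V) : s(v, w) ∉ Γ := fun h => by
      obtain ⟨t, ht, htr⟩ := hr _ h
      rcases Sym2.mem_iff.1 htr with rfl | rfl
      exacts [hv ht, hw ht]
    have hab := hinner hbV ha
    have hac := hinner hcV ha
    have hbc := hinner hcV hbV
    have hux : u ≠ x := fun h => huV (h ▸ hxV)
    have huy : u ≠ y := fun h => huV (h ▸ hyV)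
    have huz : u ≠ z := fun h => huV (h ▸ hzV)
    rcases heE with ((heE | rfl | rfl | rfl) | rfl | rfl | rfl) | rfl | rfl | rfl
    · exact absurd (hold heE u hue) huV
    all_goals rcases Sym2.mem_iff.1 hue with h | h <;> first | contradiction | simp [h, he]
  have hface (f : Finset ℕ) (h : f = {c, a, b} ∨ f = {c, b, x} ∨ f = {c, x, a}) :
      ∃ u ∈ gv Γ, u ∈ f :=
    hΓF f (by simp only [faces, hF', Finset.mem_insert, Finset.mem_union,
      Finset.mem_singleton]; tauto)
  by_cases hx : x ∈ gv Γ
  · obtain ⟨u, hu, huf⟩ := hface {c, a, b} (by simp)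
    have huV : u ∉ V := by simp at huf; grind
    have guarded (v w : ℕ) (h : s(w, v) ∈ Γ) (hv : v ∈ ({x, y, z} : Finset ℕ))
        (hw : w ∈ ({a, b, c} : Finset ℕ)) : ∃ Γ' : Finset (Sym2 ℕ), IsGuardSet E' out F' Γ' ∧
          Γ'.card ≤ Γ.card ∧ x ∈ gv Γ' ∧ ∃ v w : ℕ, s(v, w) ∈ Γ' ∧
          v ∈ ({x, y, z} : Finset ℕ) ∧ w ∈ ({a, b, c} : Finset ℕ) :=
      ⟨Γ, ⟨hΓE, hΓF⟩, le_rfl, hx, v, w, Sym2.eq_swap ▸ h, hv, hw⟩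
    rcases hnew u hu huV with ⟨-, h | h | h⟩ | ⟨-, h | h⟩ | ⟨-, h⟩ <;>
      exact guarded _ _ h (by simp) (by simp)
  have hxa : s(a, x) ∉ Γ := fun h => hx (mem_gv_right h)
  have hxb : s(b, x) ∉ Γ := fun h => hx (mem_gv_right h)
  have hxc : s(c, x) ∉ Γ := fun h => hx (mem_gv_right h)
  have hby : s(b, y) ∈ Γ := by
    obtain ⟨u, hu, huf⟩ := hface {c, b, x} (by simp)
    simp only [Finset.mem_insert, Finset.mem_singleton] at huf
    have := hnew u hu
    grind
  have hayz : s(a, y) ∈ Γ ∨ s(a, z) ∈ Γ := by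
    obtain ⟨u, hu, huf⟩ := hface {c, x, a} (by simp)
    simp only [Finset.mem_insert, Finset.mem_singleton] at huf
    have := hnew u hu
    grind
  rcases hayz with hay | haz
  · refine ⟨insert s(a, x) (Γ.erase s(a, y)), guards (exchange hΓE haxE) ?_ ?_ fun u hu huΓ => ?_,
      card_insert_erase_le hay _, ?_, x, a, ?_, by simp, by simp⟩
    · exact mem_gv_right (Finset.mem_insert_self _ _)
    · exact mem_gv_left (Finset.mem_insert_self _ _)
    · by_cases huy : u = y
      · subst huy
        refine mem_gv_right (u := b) (Finset.mem_insert_of_mem (Finset.mem_erase.2 ⟨?_, hby⟩))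
        simp only [ne_eq, Sym2.eq_iff]; grind
      · exact mem_gv_insert_erase _ _ huΓ (by simp only [Sym2.mem_iff]; grind)
    · exact mem_gv_right (Finset.mem_insert_self _ _)
    · rw [Sym2.eq_swap]; exact Finset.mem_insert_self _ _
  · have hne : s(a, z) ≠ s(b, y) := by simp only [ne_eq, Sym2.eq_iff]; grind
    have hyz_ne : s(y, z) ≠ s(a, z) := by simp only [ne_eq, Sym2.eq_iff]; grind
    have haz' : s(a, z) ∈ insert s(y, z) (Γ.erase s(b, y)) :=
      Finset.mem_insert_of_mem (Finset.mem_erase.2 ⟨hne, haz⟩)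
    have hyz' : s(y, z) ∈ insert s(a, x) ((insert s(y, z) (Γ.erase s(b, y))).erase s(a, z)) :=
      Finset.mem_insert_of_mem (Finset.mem_erase.2 ⟨hyz_ne, Finset.mem_insert_self _ _⟩)
    refine ⟨insert s(a, x) ((insert s(y, z) (Γ.erase s(b, y))).erase s(a, z)),
      guards (exchange (exchange hΓE hyzE') haxE) ?_ ?_ fun u hu huΓ => ?_,
      (card_insert_erase_le haz' _).trans (card_insert_erase_le hby _), ?_, x, a, ?_,
      by simp, by simp⟩
    · exact mem_gv_right (Finset.mem_insert_self _ _)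
    · exact mem_gv_left (Finset.mem_insert_self _ _)
    · by_cases huy : u = y
      · rw [huy]; exact mem_gv_left hyz'
      by_cases huz : u = z
      · rw [huz]; exact mem_gv_right hyz'
      refine mem_gv_insert_erase _ _ (mem_gv_insert_erase _ _ huΓ ?_) ?_ <;>
        simp only [Sym2.mem_iff] <;> grind
    · exact mem_gv_right (Finset.mem_insert_self _ _)
    · rw [Sym2.eq_swap]; exact Finset.mem_insert_self _ _

end Guarding
end
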